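/- arXiv:2502.11806 — 6 statements merged into one kernel-verified Lean document; each statement's English description precedes it below -/
import Mathlib

section
/- (Theorem 1, optimality of Algorithm 1) Let M ∈ ℝ^{d×N}, let 𝟙 ∈ ℝ^N be the all-ones vector, let S' = (1/N)·M𝟙 be the column mean of M, and let R = M − S'𝟙ᵀ. Suppose X* ∈ ℝ^{d×N} has rank at most r, satisfies X*𝟙 = 0, and minimizes ‖R − X‖_F over all matrices X ∈ ℝ^{d×N} of rank at most r. Then there exist S̃ ∈ ℝ^d, Ẽ ∈ ℝ^{d×r}, Γ̃ ∈ ℝ^{N×r} with S̃ᵀẼ = 0 and S̃𝟙ᵀ + ẼΓ̃ᵀ = S'𝟙ᵀ + X*, and every such triple (S̃, Ẽ, Γ̃) attains the infimum of ‖M − S𝟙ᵀ − EΓᵀ‖_F over all triples (S, E, Γ) ∈ ℝ^d × ℝ^{d×r} × ℝ^{N×r} satisfying SᵀE = 0. -/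
open Matrix

/-- The all-ones vector `𝟙 ∈ ℝ^N`. -/
def ones (N : ℕ) : Fin N → ℝ := fun _ => 1

/-- The matrix `S𝟙ᵀ ∈ ℝ^{d×N}` whose columns all equal `S`. -/
def colRep {d : ℕ} (N : ℕ) (S : Fin d → ℝ) : Matrix (Fin d) (Fin N) ℝ :=
  Matrix.of fun i _ => S i

/-- The Frobenius norm of a real matrix. -/
noncomputable def frob {d N : ℕ} (A : Matrix (Fin d) (Fin N) ℝ) : ℝ :=
  Real.sqrt (∑ i, ∑ j, (A i j) ^ 2)

/-- The matrix obtained from `A` by subtracting the mean of its columns from each column. -/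
noncomputable def centerCols {d N : ℕ} (A : Matrix (Fin d) (Fin N) ℝ) :
    Matrix (Fin d) (Fin N) ℝ :=
  A - colRep N ((N : ℝ)⁻¹ • A.mulVec (ones N))

lemma centerCols_apply {d N : ℕ} (A : Matrix (Fin d) (Fin N) ℝ) (i : Fin d) (j : Fin N) :
    centerCols A i j = A i j - (N : ℝ)⁻¹ * ∑ k, A i k := by
  simp [centerCols, colRep, ones, Matrix.mulVec, dotProduct]

lemma centerCols_sub {d N : ℕ} (A B : Matrix (Fin d) (Fin N) ℝ) :
    centerCols (A - B) = centerCols A - centerCols B := by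
  ext i j
  simp only [centerCols_apply, Matrix.sub_apply, Finset.sum_sub_distrib]
  ring

lemma centerCols_colRep {d N : ℕ} (S : Fin d → ℝ) : centerCols (colRep N S) = 0 := by
  ext i j
  have hN : (N : ℝ) ≠ 0 := Nat.cast_ne_zero.mpr j.pos.ne'
  simp [centerCols_apply, colRep, hN]

lemma centerCols_mul {d n N : ℕ} (A : Matrix (Fin d) (Fin n) ℝ) (B : Matrix (Fin n) (Fin N) ℝ) :
    centerCols (A * B) = A * centerCols B := by
  ext i j
  simp only [centerCols_apply, Matrix.mul_apply, mul_sub, Finset.sum_sub_distrib]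
  rw [Finset.sum_comm]
  simp only [Finset.mul_sum, mul_left_comm]

lemma sum_sub_mean_sq_le {N : ℕ} (a : Fin N → ℝ) :
    ∑ j, (a j - (N : ℝ)⁻¹ * ∑ k, a k) ^ 2 ≤ ∑ j, a j ^ 2 := by
  obtain rfl | hN := N.eq_zero_or_pos
  · simp
  have hN' : (N : ℝ) ≠ 0 := Nat.cast_ne_zero.mpr hN.ne'
  have h : ∑ j, (a j - (N : ℝ)⁻¹ * ∑ k, a k) ^ 2 =
      ∑ j, a j ^ 2 - (N : ℝ)⁻¹ * (∑ k, a k) ^ 2 := by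
    simp only [sub_sq, Finset.sum_add_distrib, Finset.sum_sub_distrib, ← Finset.sum_mul,
      ← Finset.mul_sum, Finset.sum_const, Finset.card_univ, Fintype.card_fin, nsmul_eq_mul]
    field_simp
    ring
  rw [h]
  exact sub_le_self _ (by positivity)

lemma frob_centerCols_le {d N : ℕ} (A : Matrix (Fin d) (Fin N) ℝ) :
    frob (centerCols A) ≤ frob A := by
  refine Real.sqrt_le_sqrt (Finset.sum_le_sum fun i _ => ?_)
  simpa only [centerCols_apply] using sum_sub_mean_sq_le (A i)

/-- A matrix of rank at most `r` factors through `r` columns. -/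
lemma exists_eq_mul_of_rank_le {d N r : ℕ} (X : Matrix (Fin d) (Fin N) ℝ) (hX : X.rank ≤ r) :
    ∃ (E : Matrix (Fin d) (Fin r) ℝ) (B : Matrix (Fin r) (Fin N) ℝ), X = E * B := by
  rw [Matrix.rank_eq_finrank_span_cols] at hX
  obtain ⟨f, -, hf, -⟩ := Submodule.exists_fun_fin_finrank_span_eq ℝ (Set.range X.col)
  let E : Matrix (Fin d) (Fin r) ℝ := Matrix.of fun i j => if h : j.val < _ then f ⟨j, h⟩ i else 0
  have hE : Submodule.span ℝ (Set.range X.col) ≤ LinearMap.range E.mulVecLin := by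
    rw [← hf, Submodule.span_le]
    rintro _ ⟨k, rfl⟩
    refine ⟨Pi.single (Fin.castLE hX k) 1, ?_⟩
    ext i
    simp [E]
  choose b hb using fun j => hE (Submodule.subset_span ⟨j, rfl⟩)
  refine ⟨E, Matrix.of fun k j => b j k, ?_⟩
  ext i j
  exact (congrFun (hb j) i).symm

/-- The normal equations of a linear least-squares problem are solvable. -/
lemma exists_vecMul_sub_mulVec_eq_zero {d r : ℕ} (E : Matrix (Fin d) (Fin r) ℝ) (v : Fin d → ℝ) :
    ∃ g : Fin r → ℝ, Matrix.vecMul (v - E.mulVec g) E = 0 := by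
  have hle : LinearMap.range (Eᵀ * E).mulVecLin ≤ LinearMap.range Eᵀ.mulVecLin := by
    rw [Matrix.mulVecLin_mul]
    exact LinearMap.range_comp_le_range _ _
  have heq := Submodule.eq_of_le_of_finrank_eq hle
    ((Matrix.rank_transpose_mul_self E).trans (Matrix.rank_transpose E).symm)
  obtain ⟨g, hg⟩ : Eᵀ.mulVecLin v ∈ LinearMap.range (Eᵀ * E).mulVecLin :=
    heq ▸ LinearMap.mem_range_self _ v
  refine ⟨g, ?_⟩
  rw [← Matrix.mulVec_transpose, Matrix.mulVec_sub, Matrix.mulVec_mulVec]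
  exact sub_eq_zero.mpr hg.symm

/-- (Theorem 1, optimality of Algorithm 1) -/
theorem algorithm_one_optimality {d N : ℕ} (r : ℕ)
    (M : Matrix (Fin d) (Fin N) ℝ)
    (S' : Fin d → ℝ) (hS' : S' = (N : ℝ)⁻¹ • M.mulVec (ones N))
    (R : Matrix (Fin d) (Fin N) ℝ) (hR : R = M - colRep N S')
    (Xstar : Matrix (Fin d) (Fin N) ℝ)
    (hrank : Xstar.rank ≤ r)
    (hker : Xstar.mulVec (ones N) = 0)
    (hmin : ∀ X : Matrix (Fin d) (Fin N) ℝ, X.rank ≤ r →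
      frob (R - Xstar) ≤ frob (R - X)) :
    (∃ (St : Fin d → ℝ) (Et : Matrix (Fin d) (Fin r) ℝ) (Γt : Matrix (Fin N) (Fin r) ℝ),
      Matrix.vecMul St Et = 0 ∧ colRep N St + Et * Γtᵀ = colRep N S' + Xstar) ∧
    (∀ (St : Fin d → ℝ) (Et : Matrix (Fin d) (Fin r) ℝ) (Γt : Matrix (Fin N) (Fin r) ℝ),
      Matrix.vecMul St Et = 0 → colRep N St + Et * Γtᵀ = colRep N S' + Xstar →
      frob (M - colRep N St - Et * Γtᵀ) =
        sInf {x : ℝ | ∃ (S : Fin d → ℝ) (E : Matrix (Fin d) (Fin r) ℝ)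
            (Γ : Matrix (Fin N) (Fin r) ℝ),
          Matrix.vecMul S E = 0 ∧ x = frob (M - colRep N S - E * Γᵀ)}) := by
  constructor
  · obtain ⟨E, B, rfl⟩ := exists_eq_mul_of_rank_le Xstar hrank
    obtain ⟨g, hg⟩ := exists_vecMul_sub_mulVec_eq_zero E S'
    refine ⟨S' - E.mulVec g, E, (B + colRep N g)ᵀ, hg, ?_⟩
    have hcol : E * colRep N g = colRep N (E.mulVec g) := rfl
    rw [Matrix.transpose_transpose, Matrix.mul_add, hcol]
    ext i j
    simp only [Matrix.add_apply, colRep, Matrix.of_apply, Pi.sub_apply]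
    ring
  · intro St Et Γt horth hsum
    symm
    refine IsLeast.csInf_eq ⟨⟨St, Et, Γt, horth, rfl⟩, ?_⟩
    rintro _ ⟨S, E, Γ, -, rfl⟩
    have hres : M - colRep N St - Et * Γtᵀ = R - Xstar := by
      rw [sub_sub, hsum, hR, sub_sub]
    have hcenter : centerCols (M - colRep N S - E * Γᵀ) = R - E * centerCols Γᵀ := by
      rw [centerCols_sub, centerCols_sub, centerCols_colRep, centerCols_mul, sub_zero, hR, hS']
      rfl
    have hr : (E * centerCols Γᵀ).rank ≤ r :=
      (Matrix.rank_mul_le_left _ _).trans (Matrix.rank_le_width E)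
    calc frob (M - colRep N St - Et * Γtᵀ) = frob (R - Xstar) := by rw [hres]
      _ ≤ frob (R - E * centerCols Γᵀ) := hmin _ hr
      _ = frob (centerCols (M - colRep N S - E * Γᵀ)) := by rw [hcenter]
      _ ≤ frob (M - colRep N S - E * Γᵀ) := frob_centerCols_le _
end

section
/- (Constraint is value-preserving) For every M ∈ ℝ^{d×N} and every r ∈ ℕ, the infimum of ‖M − S𝟙ᵀ − EΓᵀ‖_F over all triples (S, E, Γ) ∈ ℝ^d × ℝ^{d×r} × ℝ^{N×r} equals the infimum of the same quantity taken only over triples that additionally satisfy the orthogonality constraint SᵀE = 0. -/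
open Matrix

/-- The normal equations `AᵀA w = Aᵀ b` of a least-squares problem are solvable. -/
theorem exists_transpose_mul_self_mulVec_eq {m n : Type*} [Fintype m] [Fintype n]
    (A : Matrix m n ℝ) (b : m → ℝ) : ∃ w : n → ℝ, (Aᵀ * A) *ᵥ w = Aᵀ *ᵥ b := by
  have hle : LinearMap.range (Aᵀ * A).mulVecLin ≤ LinearMap.range Aᵀ.mulVecLin := by
    rw [Matrix.mulVecLin_mul]
    exact LinearMap.range_comp_le_range _ _
  have hrank : (Aᵀ * A).rank = Aᵀ.rank := by
    rw [Matrix.rank_transpose_mul_self, Matrix.rank_transpose]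
  have hmem : Aᵀ *ᵥ b ∈ LinearMap.range (Aᵀ * A).mulVecLin := by
    rw [Submodule.eq_of_le_of_finrank_eq hle hrank]
    exact ⟨b, rfl⟩
  exact hmem

/-- Subtracting from `S` its projection onto the column space of `E`, and absorbing the difference
into `Γ`, makes `S` orthogonal to `E` without changing the fitted matrix. -/
theorem exists_orthogonal_colRep_add_mul_eq {d N r : ℕ} (S : Fin d → ℝ)
    (E : Matrix (Fin d) (Fin r) ℝ) (Γ : Matrix (Fin N) (Fin r) ℝ) :
    ∃ (S' : Fin d → ℝ) (Γ' : Matrix (Fin N) (Fin r) ℝ),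
      Matrix.vecMul S' E = 0 ∧ colRep N S' + E * Γ'ᵀ = colRep N S + E * Γᵀ := by
  obtain ⟨w, hw⟩ := exists_transpose_mul_self_mulVec_eq E S
  refine ⟨S - E *ᵥ w, Matrix.of fun j k => Γ j k + w k, ?_, ?_⟩
  · rw [← Matrix.mulVec_transpose, Matrix.mulVec_sub, Matrix.mulVec_mulVec, hw, sub_self]
  · ext i j
    simp [colRep, Matrix.mul_apply, Matrix.mulVec, dotProduct, mul_add, Finset.sum_add_distrib]

/-- (Constraint is value-preserving) The unconstrained infimum of the objective
`‖M − S𝟙ᵀ − EΓᵀ‖_F` equals the infimum subject to the orthogonality constraint `SᵀE = 0`. -/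
theorem constraint_value_preserving {d N : ℕ} (r : ℕ) (M : Matrix (Fin d) (Fin N) ℝ) :
    sInf {x : ℝ | ∃ (S : Fin d → ℝ) (E : Matrix (Fin d) (Fin r) ℝ)
        (Γ : Matrix (Fin N) (Fin r) ℝ),
      x = frob (M - colRep N S - E * Γᵀ)} =
    sInf {x : ℝ | ∃ (S : Fin d → ℝ) (E : Matrix (Fin d) (Fin r) ℝ)
        (Γ : Matrix (Fin N) (Fin r) ℝ),
      Matrix.vecMul S E = 0 ∧ x = frob (M - colRep N S - E * Γᵀ)} := by
  congr 1
  ext x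
  constructor
  · rintro ⟨S, E, Γ, rfl⟩
    obtain ⟨S', Γ', horth, hfit⟩ := exists_orthogonal_colRep_add_mul_eq S E Γ
    exact ⟨S', E, Γ', horth, by rw [sub_sub, sub_sub, hfit]⟩
  · rintro ⟨S, E, Γ, -, hx⟩
    exact ⟨S, E, Γ, hx⟩
end

section
/- (Eckart–Young–Mirsky in Frobenius norm, existence and value) Let B ∈ ℝ^{d×N} and r ∈ ℕ. The infimum of ‖B − X‖_F over all X ∈ ℝ^{d×N} of rank at most r is attained, and its square equals the sum of the N − r smallest eigenvalues of the positive semidefinite symmetric matrix BᵀB (counting the eigenvalues with multiplicity, and interpreting the sum as ‖B‖_F² when r = 0 and as 0 when r ≥ N). -/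
open Matrix

theorem frob_sq_eq_trace {d N : ℕ} (A : Matrix (Fin d) (Fin N) ℝ) :
    frob A ^ 2 = (Aᵀ * A).trace := by
  rw [frob, Real.sq_sqrt (by positivity), Finset.sum_comm]
  simp [Matrix.trace, Matrix.mul_apply, sq]

/-- Multiplying on the right by a matrix with orthonormal columns does not increase the
Frobenius norm. -/
theorem frob_mul_sq_le {d N k : ℕ} (A : Matrix (Fin d) (Fin N) ℝ)
    (V : Matrix (Fin N) (Fin k) ℝ) (hV : Vᵀ * V = 1) :
    frob (A * V) ^ 2 ≤ frob A ^ 2 := by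
  have hVV : (1 - V * Vᵀ) * (1 - V * Vᵀ) = 1 - V * Vᵀ := by
    have h : V * Vᵀ * (V * Vᵀ) = V * Vᵀ := by
      rw [Matrix.mul_assoc, ← Matrix.mul_assoc Vᵀ, hV, Matrix.one_mul]
    rw [Matrix.sub_mul, Matrix.mul_sub, Matrix.mul_sub, h]
    simp
  have h : frob A ^ 2 = frob (A * V) ^ 2 + frob (A * (1 - V * Vᵀ)) ^ 2 := by
    have h₁ : ((A * V)ᵀ * (A * V)).trace = (Aᵀ * A * (V * Vᵀ)).trace := by
      rw [Matrix.transpose_mul, Matrix.mul_assoc, Matrix.trace_mul_comm]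
      simp only [Matrix.mul_assoc]
    have h₂ : ((A * (1 - V * Vᵀ))ᵀ * (A * (1 - V * Vᵀ))).trace
        = (Aᵀ * A * (1 - V * Vᵀ)).trace := by
      have ht : (1 - V * Vᵀ)ᵀ = 1 - V * Vᵀ := by simp
      rw [Matrix.transpose_mul, ht, Matrix.mul_assoc, Matrix.trace_mul_comm]
      rw [← Matrix.mul_assoc, Matrix.mul_assoc, hVV]
    rw [frob_sq_eq_trace, frob_sq_eq_trace, frob_sq_eq_trace, h₁, h₂, ← Matrix.trace_add,
      ← Matrix.mul_add]
    simp
  rw [h]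
  exact le_add_of_nonneg_right (sq_nonneg _)

/-- The kernel of a matrix has an orthonormal basis. -/
theorem exists_orthonormal_columns_mul_eq_zero {d N : ℕ} (Y : Matrix (Fin d) (Fin N) ℝ) :
    ∃ V : Matrix (Fin N) (Fin (N - Y.rank)) ℝ, Vᵀ * V = 1 ∧ Y * V = 0 := by
  have hk : Module.finrank ℝ (LinearMap.ker (Matrix.toEuclideanLin Y)) = N - Y.rank := by
    have h := LinearMap.finrank_range_add_finrank_ker (Matrix.toEuclideanLin Y)
    have hr : Y.rank = Module.finrank ℝ (LinearMap.range (Matrix.toEuclideanLin Y)) := by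
      rw [Matrix.toEuclideanLin_eq_toLin_orthonormal]
      exact Matrix.rank_eq_finrank_range_toLin Y _ _
    rw [finrank_euclideanSpace_fin, ← hr] at h
    omega
  obtain ⟨b⟩ : Nonempty (OrthonormalBasis (Fin (N - Y.rank)) ℝ
      (LinearMap.ker (Matrix.toEuclideanLin Y))) :=
    ⟨(stdOrthonormalBasis ℝ _).reindex (finCongr hk)⟩
  refine ⟨Matrix.of fun i j => (b j : EuclideanSpace ℝ (Fin N)) i, ?_, ?_⟩
  · ext i j
    have h := orthonormal_iff_ite.mp b.orthonormal i j
    rw [Submodule.coe_inner, PiLp.inner_apply] at h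
    simpa [Matrix.mul_apply, Matrix.one_apply, mul_comm] using h
  · ext i j
    have h := congrArg (fun v : EuclideanSpace ℝ (Fin d) => v i) (LinearMap.mem_ker.mp (b j).2)
    exact h

/-- A matrix with orthonormal columns has rows of norm at most one. -/
theorem mul_transpose_apply_self_le_one {N k : ℕ} (W : Matrix (Fin N) (Fin k) ℝ)
    (hW : Wᵀ * W = 1) (i : Fin N) : (W * Wᵀ) i i ≤ 1 := by
  have h : W * Wᵀ * (W * Wᵀ) = W * Wᵀ := by
    rw [Matrix.mul_assoc, ← Matrix.mul_assoc Wᵀ, hW, Matrix.one_mul]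
  have hs : ∀ j, (W * Wᵀ) j i = (W * Wᵀ) i j := fun j => by
    simp [Matrix.mul_apply, mul_comm]
  have h₁ : (W * Wᵀ) i i = ∑ j, (W * Wᵀ) i j ^ 2 := by
    conv_lhs => rw [← h, Matrix.mul_apply]
    exact Finset.sum_congr rfl fun j _ => by rw [hs, sq]
  have h₂ : (W * Wᵀ) i i ^ 2 ≤ (W * Wᵀ) i i := by
    conv_rhs => rw [h₁]
    exact Finset.single_le_sum (f := fun j => (W * Wᵀ) i j ^ 2)
      (fun j _ => sq_nonneg _) (Finset.mem_univ i)
  nlinarith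

theorem card_filter_val_lt {N m : ℕ} (hm : m ≤ N) :
    (Finset.univ.filter fun i : Fin N => (i : ℕ) < m).card = m := by
  rw [Fin.card_filter_val_lt, min_eq_right hm]

/-- A sum of nonnegative increasing reals with weights in `[0, 1]` of total mass at least `m`
is at least the sum of the `m` smallest terms. -/
theorem sum_filter_val_lt_le_sum_mul {N m : ℕ} (hm : m ≤ N) (l w : Fin N → ℝ) (hl : Monotone l)
    (hl0 : ∀ i, 0 ≤ l i) (hw0 : ∀ i, 0 ≤ w i) (hw1 : ∀ i, w i ≤ 1) (hw : (m : ℝ) ≤ ∑ i, w i) :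
    ∑ i ∈ Finset.univ.filter (fun i : Fin N => (i : ℕ) < m), l i ≤ ∑ i, l i * w i := by
  rcases Nat.eq_zero_or_pos m with rfl | hpos
  · simpa using Finset.sum_nonneg fun i _ => mul_nonneg (hl0 i) (hw0 i)
  let c := l ⟨m - 1, by omega⟩
  have hterm : ∀ i : Fin N, c * (w i - if (i : ℕ) < m then 1 else 0)
      ≤ l i * w i - if (i : ℕ) < m then l i else 0 := by
    intro i
    split_ifs with hi
    · have : l i ≤ c := hl (Fin.le_def.mpr (by simp; omega))
      nlinarith [hw1 i]
    · have : c ≤ l i := hl (Fin.le_def.mpr (by simp; omega))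
      nlinarith [hw0 i]
  have hsum := Finset.sum_le_sum fun i (_ : i ∈ Finset.univ) => hterm i
  rw [← Finset.mul_sum, Finset.sum_sub_distrib, Finset.sum_sub_distrib, Finset.sum_boole,
    card_filter_val_lt hm, ← Finset.sum_filter] at hsum
  have : 0 ≤ c * (∑ i, w i - m) := mul_nonneg (hl0 _) (sub_nonneg.mpr hw)
  linarith

/-- Real form of the spectral theorem for a Gram matrix. -/
theorem exists_orthogonal_gram_eq {d N : ℕ} (B : Matrix (Fin d) (Fin N) ℝ)
    (hH : (Bᵀ * B).IsHermitian) :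
    ∃ U : Matrix (Fin N) (Fin N) ℝ, Uᵀ * U = 1 ∧ U * Uᵀ = 1 ∧
      Bᵀ * B = U * Matrix.diagonal hH.eigenvalues * Uᵀ := by
  refine ⟨hH.eigenvectorUnitary, ?_, ?_, ?_⟩
  · simpa [Matrix.star_eq_conjTranspose] using Unitary.coe_star_mul_self hH.eigenvectorUnitary
  · simpa [Matrix.star_eq_conjTranspose] using Unitary.coe_mul_star_self hH.eigenvectorUnitary
  · have h := hH.spectral_theorem
    rw [Unitary.conjStarAlgAut_apply] at h
    simpa [Matrix.star_eq_conjTranspose, Function.comp_def] using h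

/-- Compressing `B` to `k ≥ m` orthonormal columns leaves at least the sum of the `m` smallest
eigenvalues of `Bᵀ * B` (Ky Fan). -/
theorem sum_smallest_eigenvalues_le_frob_mul_sq {d N k m : ℕ} (hm : m ≤ N) (hmk : m ≤ k)
    (B : Matrix (Fin d) (Fin N) ℝ) (hH : (Bᵀ * B).IsHermitian)
    (V : Matrix (Fin N) (Fin k) ℝ) (hV : Vᵀ * V = 1) :
    ∑ i ∈ Finset.univ.filter (fun i : Fin N => (i : ℕ) < m),
      hH.eigenvalues (Tuple.sort hH.eigenvalues i) ≤ frob (B * V) ^ 2 := by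
  obtain ⟨U, -, hU, hspec⟩ := exists_orthogonal_gram_eq B hH
  have hl0 : ∀ i, 0 ≤ hH.eigenvalues i := by
    have : (Bᵀ * B).PosSemidef := by
      simpa using Matrix.posSemidef_conjTranspose_mul_self B
    exact this.eigenvalues_nonneg
  generalize hH.eigenvalues = l at hspec hl0 ⊢
  let W := Uᵀ * V
  have hW : Wᵀ * W = 1 := by
    simp only [W, Matrix.transpose_mul, Matrix.transpose_transpose]
    rw [Matrix.mul_assoc, ← Matrix.mul_assoc U, hU, Matrix.one_mul, hV]
  have hfrob : frob (B * V) ^ 2 = ∑ i, l i * (W * Wᵀ) i i := by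
    have : (B * V)ᵀ * (B * V) = Wᵀ * (Matrix.diagonal l * W) := by
      rw [Matrix.transpose_mul, Matrix.mul_assoc, ← Matrix.mul_assoc Bᵀ, hspec]
      simp only [W, Matrix.transpose_mul, Matrix.transpose_transpose, Matrix.mul_assoc]
    rw [frob_sq_eq_trace, this, Matrix.trace_mul_comm, Matrix.mul_assoc]
    simp [Matrix.trace, Matrix.diagonal_mul]
  let σ := Tuple.sort l
  rw [hfrob, ← Equiv.sum_comp σ]
  refine sum_filter_val_lt_le_sum_mul hm (fun i => l (σ i))
    (fun i => (W * Wᵀ) (σ i) (σ i)) (Tuple.monotone_sort l) (fun i => hl0 _)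
    (fun i => ?_) (fun i => mul_transpose_apply_self_le_one W hW _) ?_
  · rw [Matrix.mul_apply]
    exact Finset.sum_nonneg fun j _ => mul_self_nonneg (W (σ i) j)
  · rw [Equiv.sum_comp σ fun i => (W * Wᵀ) i i]
    have : (W * Wᵀ).trace = k := by rw [Matrix.trace_mul_comm, hW]; simp
    rw [Matrix.trace] at this
    simp only [Matrix.diag_apply] at this
    rw [this]
    exact_mod_cast hmk

/-- Discarding the components of `B` along the eigenvectors indexed by `s` yields a matrix at
squared distance `∑ i ∈ s, λ i` from `B`. -/
theorem exists_rank_le_card_compl_frob_sub_sq_eq {d N : ℕ} (B : Matrix (Fin d) (Fin N) ℝ)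
    (hH : (Bᵀ * B).IsHermitian) (s : Finset (Fin N)) :
    ∃ X : Matrix (Fin d) (Fin N) ℝ, X.rank ≤ N - s.card ∧
      frob (B - X) ^ 2 = ∑ i ∈ s, hH.eigenvalues i := by
  obtain ⟨U, hU', hU, hspec⟩ := exists_orthogonal_gram_eq B hH
  generalize hH.eigenvalues = l at hspec ⊢
  let D : Matrix (Fin N) (Fin N) ℝ := Matrix.diagonal fun i => if i ∈ s then 0 else 1
  let E : Matrix (Fin N) (Fin N) ℝ := Matrix.diagonal fun i => if i ∈ s then 1 else 0
  have hDE : 1 - D = E := by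
    ext i j
    by_cases hij : i = j
    · subst hij; by_cases hi : i ∈ s <;> simp [D, E, hi]
    · simp [D, E, hij]
  refine ⟨B * (U * D * Uᵀ), ?_, ?_⟩
  · refine (Matrix.rank_mul_le_right _ _).trans <| (Matrix.rank_mul_le_left _ _).trans <|
      (Matrix.rank_mul_le_right _ _).trans ?_
    rw [Matrix.rank_diagonal, Fintype.card_subtype]
    simp [← Finset.compl_filter, Finset.card_compl]
  · have hsub : B - B * (U * D * Uᵀ) = B * (U * E * Uᵀ) := by
      rw [← hDE, Matrix.mul_sub, Matrix.sub_mul, Matrix.mul_one, hU, Matrix.mul_sub,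
        Matrix.mul_one]
    have hgram : (B * (U * E * Uᵀ))ᵀ * (B * (U * E * Uᵀ))
        = U * (E * (Matrix.diagonal l * E)) * Uᵀ := by
      have hE : Eᵀ = E := Matrix.diagonal_transpose _
      calc (B * (U * E * Uᵀ))ᵀ * (B * (U * E * Uᵀ))
          = U * E * Uᵀ * (Bᵀ * B) * (U * E * Uᵀ) := by
            simp only [Matrix.transpose_mul, Matrix.transpose_transpose, hE, Matrix.mul_assoc]
        _ = U * E * (Uᵀ * U) * Matrix.diagonal l * (Uᵀ * U) * E * Uᵀ := by
            rw [hspec]; simp only [Matrix.mul_assoc]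
        _ = _ := by rw [hU']; simp only [Matrix.mul_assoc, Matrix.mul_one]
    rw [hsub, frob_sq_eq_trace, hgram, Matrix.trace_mul_comm, ← Matrix.mul_assoc, hU',
      Matrix.one_mul]
    simp [E, Matrix.diagonal_mul_diagonal, Matrix.trace_diagonal]

/-- (Eckart–Young–Mirsky in Frobenius norm, existence and value) The infimum of
`‖B − X‖_F` over matrices `X` of rank at most `r` is attained, and its square equals
the sum of the `N − r` smallest eigenvalues (with multiplicity) of `BᵀB`. -/
theorem eckart_young_mirsky {d N : ℕ} (r : ℕ) (B : Matrix (Fin d) (Fin N) ℝ)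
    (hH : (Bᵀ * B).IsHermitian) :
    ∃ X : Matrix (Fin d) (Fin N) ℝ, X.rank ≤ r ∧
      (∀ Y : Matrix (Fin d) (Fin N) ℝ, Y.rank ≤ r → frob (B - X) ≤ frob (B - Y)) ∧
      frob (B - X) ^ 2 =
        ∑ i ∈ Finset.univ.filter (fun i : Fin N => (i : ℕ) < N - r),
          hH.eigenvalues (Tuple.sort hH.eigenvalues i) := by
  obtain ⟨X, hXr, hX⟩ := exists_rank_le_card_compl_frob_sub_sq_eq B hH
    ((Finset.univ.filter fun i : Fin N => (i : ℕ) < N - r).map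
      (Tuple.sort hH.eigenvalues).toEmbedding)
  rw [Finset.card_map, card_filter_val_lt (Nat.sub_le N r)] at hXr
  rw [Finset.sum_map] at hX
  refine ⟨X, by omega, fun Y hY => ?_, hX⟩
  obtain ⟨V, hV, hYV⟩ := exists_orthonormal_columns_mul_eq_zero Y
  refine le_of_pow_le_pow_left₀ two_ne_zero (Real.sqrt_nonneg _) ?_
  calc frob (B - X) ^ 2 ≤ frob (B * V) ^ 2 := hX.trans_le <|
        sum_smallest_eigenvalues_le_frob_mul_sq (Nat.sub_le N r) (by omega) B hH V hV
    _ = frob ((B - Y) * V) ^ 2 := by rw [Matrix.sub_mul, hYV, sub_zero]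
    _ ≤ frob (B - Y) ^ 2 := frob_mul_sq_le _ V hV
end

section
/- (Kernel-preserving improvement of low-rank approximants) Let B ∈ ℝ^{d×N} and v ∈ ℝ^N be nonzero with Bv = 0. For every X ∈ ℝ^{d×N} of rank at most r, the matrix X' = X(I − vvᵀ/‖v‖²) satisfies rank X' ≤ r, X'v = 0, and ‖B − X'‖_F ≤ ‖B − X‖_F. In particular, if B𝟙 = 0 then the minimum of ‖B − X‖_F over matrices of rank at most r is attained at some X with X𝟙 = 0. -/
open Matrix

/-- The squared Euclidean norm of a vector. -/
def sqnorm {n : ℕ} (v : Fin n → ℝ) : ℝ := ∑ i, (v i) ^ 2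

theorem sqnorm_pos {n : ℕ} {v : Fin n → ℝ} (hv : v ≠ 0) : 0 < sqnorm v := by
  obtain ⟨i, hi⟩ := Function.ne_iff.mp hv
  exact Finset.sum_pos' (fun _ _ => sq_nonneg _) ⟨i, Finset.mem_univ i, sq_pos_of_ne_zero hi⟩

theorem sqnorm_eq_dotProduct {n : ℕ} (v : Fin n → ℝ) : sqnorm v = v ⬝ᵥ v := by
  simp [sqnorm, dotProduct, sq]

theorem mul_one_sub_smul_vecMulVec {d N : ℕ} (A : Matrix (Fin d) (Fin N) ℝ) (c : ℝ)
    (v : Fin N → ℝ) :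
    A * (1 - c • vecMulVec v v) = A - c • vecMulVec (A *ᵥ v) v := by
  rw [Matrix.mul_sub, Matrix.mul_one, Matrix.mul_smul, mul_vecMulVec]

theorem mul_one_sub_smul_vecMulVec_mulVec {d N : ℕ} (A : Matrix (Fin d) (Fin N) ℝ)
    {v : Fin N → ℝ} (hv : v ≠ 0) :
    (A * (1 - (sqnorm v)⁻¹ • vecMulVec v v)) *ᵥ v = 0 := by
  have hs := (sqnorm_pos hv).ne'
  ext i
  rw [mul_one_sub_smul_vecMulVec, Matrix.sub_mulVec, Matrix.smul_mulVec, vecMulVec_mulVec,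
    ← sqnorm_eq_dotProduct]
  simp only [Pi.sub_apply, Pi.smul_apply, MulOpposite.smul_eq_mul_unop, MulOpposite.unop_op,
    smul_eq_mul, Pi.zero_apply]
  field_simp
  ring

theorem sum_sq_sub_proj_le {n : ℕ} {v : Fin n → ℝ} (hv : v ≠ 0) (y : Fin n → ℝ) :
    ∑ j, (y j - (sqnorm v)⁻¹ * ((y ⬝ᵥ v) * v j)) ^ 2 ≤ ∑ j, y j ^ 2 := by
  have hs := sqnorm_pos hv
  have key : ∑ j, (y j - (sqnorm v)⁻¹ * ((y ⬝ᵥ v) * v j)) ^ 2 =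
      ∑ j, y j ^ 2 - 2 * (sqnorm v)⁻¹ * (y ⬝ᵥ v) * (y ⬝ᵥ v) +
        ((sqnorm v)⁻¹ * (y ⬝ᵥ v)) ^ 2 * sqnorm v := by
    generalize hc : (sqnorm v)⁻¹ = c
    generalize hp : y ⬝ᵥ v = p
    conv_rhs => enter [1, 2, 2]; rw [← hp]
    simp only [dotProduct, sqnorm, Finset.mul_sum]
    rw [← Finset.sum_sub_distrib, ← Finset.sum_add_distrib]
    exact Finset.sum_congr rfl fun j _ => by ring
  have hsimp : ((sqnorm v)⁻¹ * (y ⬝ᵥ v)) ^ 2 * sqnorm v =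
      (sqnorm v)⁻¹ * (y ⬝ᵥ v) * (y ⬝ᵥ v) := by
    field_simp
  have hnonneg : 0 ≤ (sqnorm v)⁻¹ * ((y ⬝ᵥ v) * (y ⬝ᵥ v)) :=
    mul_nonneg (inv_nonneg.mpr hs.le) (mul_self_nonneg _)
  linarith

theorem frob_mul_one_sub_le {d N : ℕ} (A : Matrix (Fin d) (Fin N) ℝ) {v : Fin N → ℝ}
    (hv : v ≠ 0) :
    frob (A * (1 - (sqnorm v)⁻¹ • vecMulVec v v)) ≤ frob A := by
  rw [mul_one_sub_smul_vecMulVec]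
  exact Real.sqrt_le_sqrt <| Finset.sum_le_sum fun i _ => sum_sq_sub_proj_le hv (A i)

theorem frob_sub_mul_one_sub_le {d N : ℕ} {B : Matrix (Fin d) (Fin N) ℝ} {v : Fin N → ℝ}
    (hv : v ≠ 0) (hB : B *ᵥ v = 0) (X : Matrix (Fin d) (Fin N) ℝ) :
    frob (B - X * (1 - (sqnorm v)⁻¹ • vecMulVec v v)) ≤ frob (B - X) := by
  have hBP : B * (1 - (sqnorm v)⁻¹ • vecMulVec v v) = B := by
    simp [mul_one_sub_smul_vecMulVec, hB]
  conv_lhs => rw [← hBP, ← Matrix.sub_mul]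
  exact frob_mul_one_sub_le _ hv

theorem isClosed_setOf_rank_le (d N r : ℕ) :
    IsClosed {X : Matrix (Fin d) (Fin N) ℝ | X.rank ≤ r} := by
  let f : Matrix (Fin d) (Fin N) ℝ →ₗ[ℝ] (Fin N → ℝ) →L[ℝ] (Fin d → ℝ) :=
    LinearMap.toContinuousLinearMap.toLinearMap ∘ₗ Matrix.toLin'.toLinearMap
  have hf : Continuous f := f.continuous_of_finiteDimensional
  have h := ((isOpen_setOfPred_nat_le_rank (𝕜 := ℝ) (E := Fin N → ℝ) (F := Fin d → ℝ)
    (r + 1)).preimage hf).isClosed_compl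
  convert! h using 1
  ext X
  have hX : (f X : (Fin N → ℝ) →ₗ[ℝ] (Fin d → ℝ)).rank = (X.rank : Cardinal) :=
    (Module.finrank_eq_rank ℝ _).symm
  change X.rank ≤ r ↔ ¬ ((r + 1 : ℕ) : Cardinal) ≤ (f X : (Fin N → ℝ) →ₗ[ℝ] (Fin d → ℝ)).rank
  rw [hX, Nat.cast_le]
  lia

open scoped Matrix.Norms.Frobenius in
theorem frob_eq_norm {d N : ℕ} (A : Matrix (Fin d) (Fin N) ℝ) : frob A = ‖A‖ := by
  simp [frob, frobenius_norm_def, Real.sqrt_eq_rpow]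

open scoped Matrix.Norms.Frobenius in
theorem exists_rank_le_forall_frob_sub_le {d N : ℕ} (r : ℕ) (B : Matrix (Fin d) (Fin N) ℝ) :
    ∃ X₀ : Matrix (Fin d) (Fin N) ℝ, X₀.rank ≤ r ∧
      ∀ X : Matrix (Fin d) (Fin N) ℝ, X.rank ≤ r → frob (B - X₀) ≤ frob (B - X) := by
  have : ProperSpace (Matrix (Fin d) (Fin N) ℝ) := FiniteDimensional.proper_real _
  obtain ⟨X₀, hX₀, hdist⟩ := (isClosed_setOf_rank_le d N r).exists_infDist_eq_dist
    ⟨0, by simp⟩ B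
  refine ⟨X₀, hX₀, fun X hX => ?_⟩
  rw [frob_eq_norm, frob_eq_norm, ← dist_eq_norm, ← dist_eq_norm, ← hdist]
  exact Metric.infDist_le_dist_of_mem hX

/-- (Kernel-preserving improvement of low-rank approximants) If `v ≠ 0` and `Bv = 0`,
then for every `X` of rank at most `r`, the matrix `X' = X(I − vvᵀ/‖v‖²)` has rank at
most `r`, satisfies `X'v = 0`, and `‖B − X'‖_F ≤ ‖B − X‖_F`. In particular, if
`B𝟙 = 0` then the minimum of `‖B − X‖_F` over rank-`≤ r` matrices is attained at some
`X` with `X𝟙 = 0`. -/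
theorem kernel_preserving_improvement {d N : ℕ} (r : ℕ) (B : Matrix (Fin d) (Fin N) ℝ) :
    (∀ v : Fin N → ℝ, v ≠ 0 → B.mulVec v = 0 →
      ∀ X : Matrix (Fin d) (Fin N) ℝ, X.rank ≤ r →
        (X * (1 - (sqnorm v)⁻¹ • Matrix.vecMulVec v v)).rank ≤ r ∧
        (X * (1 - (sqnorm v)⁻¹ • Matrix.vecMulVec v v)).mulVec v = 0 ∧
        frob (B - X * (1 - (sqnorm v)⁻¹ • Matrix.vecMulVec v v)) ≤ frob (B - X)) ∧
    (B.mulVec (ones N) = 0 →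
      ∃ X₀ : Matrix (Fin d) (Fin N) ℝ, X₀.rank ≤ r ∧ X₀.mulVec (ones N) = 0 ∧
        ∀ X : Matrix (Fin d) (Fin N) ℝ, X.rank ≤ r → frob (B - X₀) ≤ frob (B - X)) := by
  have rank_le (v : Fin N → ℝ) {X : Matrix (Fin d) (Fin N) ℝ} (hX : X.rank ≤ r) :
      (X * (1 - (sqnorm v)⁻¹ • vecMulVec v v)).rank ≤ r :=
    (rank_mul_le_left _ _).trans hX
  refine ⟨fun v hv hB X hX => ⟨rank_le v hX, mul_one_sub_smul_vecMulVec_mulVec X hv,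
    frob_sub_mul_one_sub_le hv hB X⟩, fun hB => ?_⟩
  obtain ⟨X₀, hX₀, hmin⟩ := exists_rank_le_forall_frob_sub_le r B
  by_cases hones : ones N = 0
  · exact ⟨X₀, hX₀, by rw [hones, mulVec_zero], hmin⟩
  · exact ⟨_, rank_le (ones N) hX₀, mul_one_sub_smul_vecMulVec_mulVec X₀ hones,
      fun X hX => (frob_sub_mul_one_sub_le hones hB X₀).trans (hmin X hX)⟩
end

section
/- (Phase 3 of Algorithm 1: pseudoinverse recovery of the common component) Let s ∈ ℝ^d be nonzero, E ∈ ℝ^{d×r} and Γ ∈ ℝ^{N×r} with EᵀE and ΓᵀΓ invertible, Eᵀs = 0 and Γᵀ𝟙 = 0, and set A = s𝟙ᵀ + EΓᵀ ∈ ℝ^{d×N}. Then the matrix P = (1/(N‖s‖²))·𝟙sᵀ + Γ(ΓᵀΓ)⁻¹(EᵀE)⁻¹Eᵀ ∈ ℝ^{N×d} satisfies the four Moore–Penrose equations A P A = A, P A P = P, (A P)ᵀ = A P, (P A)ᵀ = P A; moreover Pᵀ𝟙 = s/‖s‖², and hence the normalization (Pᵀ𝟙)/‖Pᵀ𝟙‖²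 recovers s exactly. -/
open Matrix

theorem dotProduct_ones_self (N : ℕ) : ones N ⬝ᵥ ones N = N := by
  simp [ones, dotProduct]

theorem dotProduct_self_eq_sqnorm {n : ℕ} (v : Fin n → ℝ) : v ⬝ᵥ v = sqnorm v := by
  simp [sqnorm, dotProduct, sq]

theorem sqnorm_ne_zero {n : ℕ} {v : Fin n → ℝ} (hv : v ≠ 0) : sqnorm v ≠ 0 := by
  rwa [← dotProduct_self_eq_sqnorm, Ne, dotProduct_self_eq_zero]

theorem sqnorm_smul {n : ℕ} (c : ℝ) (v : Fin n → ℝ) : sqnorm (c • v) = c ^ 2 * sqnorm v := by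
  simp [sqnorm, mul_pow, Finset.mul_sum]

theorem vecMulVec_zero_right {m n : ℕ} (w : Fin m → ℝ) :
    vecMulVec w (0 : Fin n → ℝ) = 0 := by
  ext
  simp [vecMulVec_apply]

theorem colRep_eq_vecMulVec {d : ℕ} (N : ℕ) (s : Fin d → ℝ) :
    colRep N s = vecMulVec s (ones N) := by
  ext i j
  simp [colRep, ones, vecMulVec_apply]

/-- (Phase 3 of Algorithm 1: pseudoinverse recovery of the common component)
With `A = s𝟙ᵀ + EΓᵀ` and `P = (1/(N‖s‖²))·𝟙sᵀ + Γ(ΓᵀΓ)⁻¹(EᵀE)⁻¹Eᵀ`, the matrix `P`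
satisfies the four Moore–Penrose equations for `A`; moreover `Pᵀ𝟙 = s/‖s‖²`, and
the normalization `(Pᵀ𝟙)/‖Pᵀ𝟙‖²` recovers `s` exactly. -/
theorem pseudoinverse_recovery {d N r : ℕ} (hN : 0 < N)
    (s : Fin d → ℝ) (hs : s ≠ 0)
    (E : Matrix (Fin d) (Fin r) ℝ) (Γ : Matrix (Fin N) (Fin r) ℝ)
    (hE : IsUnit (Eᵀ * E)) (hΓ : IsUnit (Γᵀ * Γ))
    (hsE : Eᵀ.mulVec s = 0) (hΓ1 : Γᵀ.mulVec (ones N) = 0)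
    (A : Matrix (Fin d) (Fin N) ℝ) (hA : A = colRep N s + E * Γᵀ)
    (P : Matrix (Fin N) (Fin d) ℝ)
    (hP : P = ((N : ℝ) * sqnorm s)⁻¹ • Matrix.vecMulVec (ones N) s +
        Γ * (Γᵀ * Γ)⁻¹ * (Eᵀ * E)⁻¹ * Eᵀ) :
    A * P * A = A ∧ P * A * P = P ∧ (A * P)ᵀ = A * P ∧ (P * A)ᵀ = P * A ∧
    Pᵀ.mulVec (ones N) = (sqnorm s)⁻¹ • s ∧
    (sqnorm (Pᵀ.mulVec (ones N)))⁻¹ • Pᵀ.mulVec (ones N) = s := by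
  have hN' : (N : ℝ) ≠ 0 := by positivity
  have hq : sqnorm s ≠ 0 := sqnorm_ne_zero hs
  have hsE' : s ᵥ* E = 0 := by rw [← mulVec_transpose, hsE]
  have hΓ1' : ones N ᵥ* Γ = 0 := by rw [← mulVec_transpose, hΓ1]
  have hE' : IsUnit (Eᵀ * E).det := (isUnit_iff_isUnit_det _).1 hE
  have hΓ' : IsUnit (Γᵀ * Γ).det := (isUnit_iff_isUnit_det _).1 hΓ
  rw [colRep_eq_vecMulVec] at hA
  have hAP : A * P = (sqnorm s)⁻¹ • vecMulVec s s + E * (Eᵀ * E)⁻¹ * Eᵀ := by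
    have hcross : vecMulVec s (ones N) * (Γ * (Γᵀ * Γ)⁻¹ * (Eᵀ * E)⁻¹ * Eᵀ) = 0 := by
      simp only [Matrix.mul_assoc, vecMulVec_mul, ← vecMul_vecMul, hΓ1', zero_vecMul,
        vecMulVec_zero_right]
    have hcross' : E * Γᵀ * vecMulVec (ones N) s = 0 := by
      rw [Matrix.mul_assoc, mul_vecMulVec, hΓ1, zero_vecMulVec, Matrix.mul_zero]
    have hdiag : E * Γᵀ * (Γ * (Γᵀ * Γ)⁻¹ * (Eᵀ * E)⁻¹ * Eᵀ) = E * (Eᵀ * E)⁻¹ * Eᵀ := by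
      calc _ = E * ((Γᵀ * Γ) * (Γᵀ * Γ)⁻¹) * (Eᵀ * E)⁻¹ * Eᵀ := by simp only [Matrix.mul_assoc]
        _ = _ := by rw [mul_nonsing_inv _ hΓ', Matrix.mul_one]
    rw [hA, hP, Matrix.add_mul, Matrix.mul_add, Matrix.mul_add, Matrix.mul_smul, Matrix.mul_smul,
      hcross, hcross', hdiag, vecMulVec_mul_vecMulVec, dotProduct_ones_self, smul_zero, add_zero,
      zero_add, vecMulVec_smul, smul_smul]
    congr 2
    field_simp
  have hPA : P * A = (N : ℝ)⁻¹ • vecMulVec (ones N) (ones N) + Γ * (Γᵀ * Γ)⁻¹ * Γᵀ := by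
    have hcross : vecMulVec (ones N) s * (E * Γᵀ) = 0 := by
      rw [vecMulVec_mul, ← vecMul_vecMul, hsE', zero_vecMul, vecMulVec_zero_right]
    have hcross' : Γ * (Γᵀ * Γ)⁻¹ * (Eᵀ * E)⁻¹ * Eᵀ * vecMulVec s (ones N) = 0 := by
      rw [Matrix.mul_assoc, mul_vecMulVec, hsE, zero_vecMulVec, Matrix.mul_zero]
    have hdiag : Γ * (Γᵀ * Γ)⁻¹ * (Eᵀ * E)⁻¹ * Eᵀ * (E * Γᵀ) = Γ * (Γᵀ * Γ)⁻¹ * Γᵀ := by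
      calc _ = Γ * (Γᵀ * Γ)⁻¹ * ((Eᵀ * E)⁻¹ * (Eᵀ * E)) * Γᵀ := by simp only [Matrix.mul_assoc]
        _ = _ := by rw [nonsing_inv_mul _ hE', Matrix.mul_one]
    rw [hA, hP, Matrix.add_mul, Matrix.mul_add, Matrix.mul_add, Matrix.smul_mul, Matrix.smul_mul,
      hcross, hcross', hdiag, vecMulVec_mul_vecMulVec, dotProduct_self_eq_sqnorm, smul_zero,
      add_zero, zero_add, vecMulVec_smul, smul_smul]
    congr 2
    field_simp
  have hPT : Pᵀ *ᵥ ones N = (sqnorm s)⁻¹ • s := by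
    have hcross : ones N ᵥ* (Γ * (Γᵀ * Γ)⁻¹ * (Eᵀ * E)⁻¹ * Eᵀ) = 0 := by
      simp only [← vecMul_vecMul, hΓ1', zero_vecMul]
    rw [mulVec_transpose, hP, vecMul_add, hcross, add_zero, vecMul_smul, vecMul_vecMulVec,
      dotProduct_ones_self, smul_smul]
    congr 1
    field_simp
  refine ⟨?_, ?_, ?_, ?_, hPT, ?_⟩
  · have hs_proj : vecMulVec s s * vecMulVec s (ones N) = sqnorm s • vecMulVec s (ones N) := by
      rw [vecMulVec_mul_vecMulVec, dotProduct_self_eq_sqnorm, vecMulVec_smul]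
    have hcross : vecMulVec s s * (E * Γᵀ) = 0 := by
      rw [vecMulVec_mul, ← vecMul_vecMul, hsE', zero_vecMul, vecMulVec_zero_right]
    have hcross' : E * (Eᵀ * E)⁻¹ * Eᵀ * vecMulVec s (ones N) = 0 := by
      rw [Matrix.mul_assoc, mul_vecMulVec, hsE, zero_vecMulVec, Matrix.mul_zero]
    have hdiag : E * (Eᵀ * E)⁻¹ * Eᵀ * (E * Γᵀ) = E * Γᵀ := by
      calc _ = E * ((Eᵀ * E)⁻¹ * (Eᵀ * E)) * Γᵀ := by simp only [Matrix.mul_assoc]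
        _ = _ := by rw [nonsing_inv_mul _ hE', Matrix.mul_one]
    rw [hAP, hA, Matrix.add_mul, Matrix.mul_add, Matrix.mul_add, Matrix.smul_mul, Matrix.smul_mul,
      hs_proj, hcross, hcross', hdiag, smul_smul, inv_mul_cancel₀ hq, one_smul, smul_zero,
      add_zero, zero_add]
  · have hones_proj : vecMulVec (ones N) (ones N) * vecMulVec (ones N) s =
        (N : ℝ) • vecMulVec (ones N) s := by
      rw [vecMulVec_mul_vecMulVec, dotProduct_ones_self, vecMulVec_smul]
    have hcross : vecMulVec (ones N) (ones N) * (Γ * (Γᵀ * Γ)⁻¹ * (Eᵀ * E)⁻¹ * Eᵀ) = 0 := by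
      simp only [Matrix.mul_assoc, vecMulVec_mul, ← vecMul_vecMul, hΓ1', zero_vecMul,
        vecMulVec_zero_right]
    have hcross' : Γ * (Γᵀ * Γ)⁻¹ * Γᵀ * vecMulVec (ones N) s = 0 := by
      rw [Matrix.mul_assoc, mul_vecMulVec, hΓ1, zero_vecMulVec, Matrix.mul_zero]
    have hdiag : Γ * (Γᵀ * Γ)⁻¹ * Γᵀ * (Γ * (Γᵀ * Γ)⁻¹ * (Eᵀ * E)⁻¹ * Eᵀ) =
        Γ * (Γᵀ * Γ)⁻¹ * (Eᵀ * E)⁻¹ * Eᵀ := by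
      calc _ = Γ * ((Γᵀ * Γ)⁻¹ * (Γᵀ * Γ)) * (Γᵀ * Γ)⁻¹ * (Eᵀ * E)⁻¹ * Eᵀ := by
            simp only [Matrix.mul_assoc]
        _ = _ := by rw [nonsing_inv_mul _ hΓ', Matrix.mul_one]
    rw [hPA, hP, Matrix.add_mul, Matrix.mul_add, Matrix.mul_add, Matrix.smul_mul, Matrix.smul_mul,
      Matrix.mul_smul, Matrix.mul_smul, hones_proj, hcross, hcross', hdiag, smul_zero, smul_zero,
      add_zero, zero_add, smul_comm, inv_smul_smul₀ hN']
  · rw [hAP]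
    simp [transpose_nonsing_inv, transpose_vecMulVec, Matrix.mul_assoc]
  · rw [hPA]
    simp [transpose_nonsing_inv, transpose_vecMulVec, Matrix.mul_assoc]
  · rw [hPT, sqnorm_smul, smul_smul]
    have : ((sqnorm s)⁻¹ ^ 2 * sqnorm s)⁻¹ * (sqnorm s)⁻¹ = 1 := by field_simp
    rw [this, one_smul]
end

section
/- (Optimal value of the constrained decomposition problem) Let M ∈ ℝ^{d×N}, S' = (1/N)·M𝟙 and R = M − S'𝟙ᵀ. Then the infimum of ‖M − S𝟙ᵀ − EΓᵀ‖_F² over all triples (S, E, Γ) ∈ ℝ^d × ℝ^{d×r} × ℝ^{N×r} with SᵀE = 0 is attained and equals the sum of the N − r smallest eigenvalues of the positive semidefinite symmetric matrix RᵀR (counting eigenvalues with multiplicity, interpreting the sum as ‖R‖_F² when r = 0 and as 0 when r ≥ N). -/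
open Matrix

lemma frob_sq {d N : ℕ} (A : Matrix (Fin d) (Fin N) ℝ) : frob A ^ 2 = ∑ i, A i ⬝ᵥ A i := by
  rw [frob, Real.sq_sqrt (by positivity)]
  simp [dotProduct, sq]

lemma euclideanSpace_dotProduct_eq_inner {κ : Type*} [Fintype κ] (x : κ → ℝ)
    (y : EuclideanSpace ℝ κ) : x ⬝ᵥ y.ofLp = inner ℝ y (WithLp.toLp 2 x) := by
  simp [EuclideanSpace.inner_eq_star_dotProduct]

lemma euclideanSpace_dotProduct_self {κ : Type*} [Fintype κ] (x : κ → ℝ) :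
    x ⬝ᵥ x = ‖WithLp.toLp 2 x‖ ^ 2 := by
  rw [← real_inner_self_eq_norm_sq]
  exact euclideanSpace_dotProduct_eq_inner x (WithLp.toLp 2 x)

lemma OrthonormalBasis.sum_sq_dotProduct {ι κ : Type*} [Fintype ι] [Fintype κ]
    (u : OrthonormalBasis ι ℝ (EuclideanSpace ℝ κ)) (x : κ → ℝ) :
    ∑ i, (x ⬝ᵥ (u i).ofLp) ^ 2 = x ⬝ᵥ x := by
  simp only [euclideanSpace_dotProduct_eq_inner, euclideanSpace_dotProduct_self]
  exact u.sum_sq_inner_right _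

lemma Orthonormal.sum_sq_dotProduct_le {ι κ : Type*} [Fintype ι] [Fintype κ]
    {v : ι → EuclideanSpace ℝ κ} (hv : Orthonormal ℝ v) (x : κ → ℝ) :
    ∑ i, (x ⬝ᵥ (v i).ofLp) ^ 2 ≤ x ⬝ᵥ x := by
  simp only [euclideanSpace_dotProduct_eq_inner, euclideanSpace_dotProduct_self]
  simpa using hv.sum_inner_products_le (WithLp.toLp 2 x) (s := Finset.univ)

lemma Orthonormal.dotProduct_eq_ite {ι κ : Type*} [Fintype κ] [DecidableEq ι]
    {v : ι → EuclideanSpace ℝ κ} (hv : Orthonormal ℝ v) (i j : ι) :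
    (v i).ofLp ⬝ᵥ (v j).ofLp = if i = j then 1 else 0 := by
  rw [dotProduct_comm, euclideanSpace_dotProduct_eq_inner]
  exact orthonormal_iff_ite.mp hv i j

lemma sum_mulVec_dotProduct_self {ι κ μ : Type*} [Fintype ι] [Fintype κ] [Fintype μ]
    (A : Matrix κ μ ℝ) (v : ι → μ → ℝ) :
    ∑ k, (A *ᵥ v k) ⬝ᵥ (A *ᵥ v k) = ∑ i, ∑ k, (A i ⬝ᵥ v k) ^ 2 := by
  rw [Finset.sum_comm]
  simp [dotProduct, Matrix.mulVec, sq]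

lemma frob_sq_eq_sum_basis {ι : Type*} [Fintype ι] {d N : ℕ} (A : Matrix (Fin d) (Fin N) ℝ)
    (u : OrthonormalBasis ι ℝ (EuclideanSpace ℝ (Fin N))) :
    frob A ^ 2 = ∑ k, (A *ᵥ (u k).ofLp) ⬝ᵥ (A *ᵥ (u k).ofLp) := by
  simp only [frob_sq, sum_mulVec_dotProduct_self, u.sum_sq_dotProduct]

lemma sum_orthonormal_le_frob_sq {ι : Type*} [Fintype ι] {d N : ℕ} (A : Matrix (Fin d) (Fin N) ℝ)
    {v : ι → EuclideanSpace ℝ (Fin N)} (hv : Orthonormal ℝ v) :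
    ∑ k, (A *ᵥ (v k).ofLp) ⬝ᵥ (A *ᵥ (v k).ofLp) ≤ frob A ^ 2 := by
  rw [frob_sq, sum_mulVec_dotProduct_self]
  exact Finset.sum_le_sum fun i _ => hv.sum_sq_dotProduct_le (A i)

lemma gram_dotProduct {κ μ : Type*} [Fintype κ] [Fintype μ] (R : Matrix κ μ ℝ) (x y : μ → ℝ) :
    x ⬝ᵥ ((Rᵀ * R) *ᵥ y) = (R *ᵥ x) ⬝ᵥ (R *ᵥ y) := by
  rw [← Matrix.mulVec_mulVec, Matrix.dotProduct_mulVec, Matrix.vecMul_transpose]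

section Gram

variable {κ μ : Type*} [Fintype κ] [Fintype μ] [DecidableEq μ] (R : Matrix κ μ ℝ)
  (hH : (Rᵀ * R).IsHermitian)

lemma mulVec_eigenvector_dotProduct_self (i : μ) :
    (R *ᵥ (hH.eigenvectorBasis i).ofLp) ⬝ᵥ (R *ᵥ (hH.eigenvectorBasis i).ofLp) =
      hH.eigenvalues i := by
  rw [← gram_dotProduct, hH.mulVec_eigenvectorBasis, dotProduct_smul,
    hH.eigenvectorBasis.orthonormal.dotProduct_eq_ite]
  simp

lemma mulVec_dotProduct_self_eq_sum_eigenvalues (x : μ → ℝ) :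
    (R *ᵥ x) ⬝ᵥ (R *ᵥ x) =
      ∑ i, hH.eigenvalues i * (x ⬝ᵥ (hH.eigenvectorBasis i).ofLp) ^ 2 := by
  have h := hH.eigenvectorBasis.sum_inner_mul_inner
    (WithLp.toLp 2 ((Rᵀ * R) *ᵥ x)) (WithLp.toLp 2 x)
  rw [← gram_dotProduct, euclideanSpace_dotProduct_eq_inner x (WithLp.toLp 2 ((Rᵀ * R) *ᵥ x)), ← h]
  refine Finset.sum_congr rfl fun i _ => ?_
  rw [← euclideanSpace_dotProduct_eq_inner, ← euclideanSpace_dotProduct_eq_inner,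
    gram_dotProduct, dotProduct_comm (_ *ᵥ _), ← gram_dotProduct, hH.mulVec_eigenvectorBasis,
    dotProduct_smul, smul_eq_mul]
  ring

lemma gram_eigenvalues_nonneg (i : μ) : 0 ≤ hH.eigenvalues i := by
  rw [← mulVec_eigenvector_dotProduct_self R hH i]
  exact Finset.sum_nonneg fun _ _ => mul_self_nonneg _

end Gram

lemma sum_filter_le_sum_mul_of_monotone {N m : ℕ} (hm : m ≤ N) {f w : Fin N → ℝ}
    (hf : Monotone f) (hf0 : ∀ i, 0 ≤ f i) (hw0 : ∀ i, 0 ≤ w i) (hw1 : ∀ i, w i ≤ 1)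
    (hw : (m : ℝ) ≤ ∑ i, w i) :
    ∑ i ∈ Finset.univ.filter (fun i : Fin N => (i : ℕ) < m), f i ≤ ∑ i, f i * w i := by
  rcases Nat.eq_zero_or_pos m with rfl | hpos
  · simpa using Finset.sum_nonneg fun i _ => mul_nonneg (hf0 i) (hw0 i)
  let t := f ⟨m - 1, by omega⟩
  have key : ∀ i : Fin N, t * (w i - if (i : ℕ) < m then 1 else 0) ≤
      f i * w i - if (i : ℕ) < m then f i else 0 := by
    intro i
    split_ifs with hi
    · have : f i ≤ t := hf (Fin.le_def.mpr (by simp; omega))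
      nlinarith [hw1 i]
    · have : t ≤ f i := hf (Fin.le_def.mpr (by simp; omega))
      nlinarith [hw0 i]
  have hsum := Finset.sum_le_sum fun i (_ : i ∈ Finset.univ) => key i
  rw [← Finset.mul_sum, Finset.sum_sub_distrib, Finset.sum_sub_distrib, ← Finset.sum_filter,
    ← Finset.sum_filter, Finset.sum_const, Fin.card_filter_val_lt, min_eq_right hm] at hsum
  have : 0 ≤ t * (∑ i, w i - m) := mul_nonneg (hf0 _) (sub_nonneg.mpr hw)
  simp only [nsmul_eq_mul, mul_one] at hsum
  linarith

lemma exists_orthonormal_mulVec_eq_zero {r N : ℕ} (A : Matrix (Fin r) (Fin N) ℝ) :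
    ∃ (m : ℕ) (v : Fin m → EuclideanSpace ℝ (Fin N)),
      N - r ≤ m ∧ Orthonormal ℝ v ∧ ∀ k, A *ᵥ (v k).ofLp = 0 := by
  let K := LinearMap.ker (Matrix.toEuclideanLin A)
  let b := stdOrthonormalBasis ℝ K
  refine ⟨Module.finrank ℝ K, fun k => (b k : EuclideanSpace ℝ (Fin N)), ?_,
    b.orthonormal.comp_linearIsometry K.subtypeₗᵢ, fun k => ?_⟩
  · have h1 := (Matrix.toEuclideanLin A).finrank_range_add_finrank_ker
    have h2 := Submodule.finrank_le (LinearMap.range (Matrix.toEuclideanLin A))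
    simp only [finrank_euclideanSpace, Fintype.card_fin] at h1 h2
    change N - r ≤ Module.finrank ℝ (LinearMap.ker (Matrix.toEuclideanLin A))
    omega
  · have h := (b k).2
    rw [LinearMap.mem_ker] at h
    exact congrArg WithLp.ofLp h

/-- The lower bound in the Eckart–Young theorem. -/
lemma sum_smallest_eigenvalues_le_frob_sq_sub {d N r : ℕ} (R : Matrix (Fin d) (Fin N) ℝ)
    (hH : (Rᵀ * R).IsHermitian) (E : Matrix (Fin d) (Fin r) ℝ) (Γ : Matrix (Fin N) (Fin r) ℝ) :
    ∑ i ∈ Finset.univ.filter (fun i : Fin N => (i : ℕ) < N - r),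
      hH.eigenvalues (Tuple.sort hH.eigenvalues i) ≤ frob (R - E * Γᵀ) ^ 2 := by
  obtain ⟨m, v, hm, hv, hker⟩ := exists_orthonormal_mulVec_eq_zero Γᵀ
  let σ := Tuple.sort hH.eigenvalues
  let w : Fin N → ℝ := fun i => ∑ k, ((hH.eigenvectorBasis i).ofLp ⬝ᵥ (v k).ofLp) ^ 2
  have hw0 : ∀ i, 0 ≤ w i := fun i => Finset.sum_nonneg fun _ _ => sq_nonneg _
  have hw1 : ∀ i, w i ≤ 1 := fun i => by
    refine (hv.sum_sq_dotProduct_le _).trans ?_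
    simp [hH.eigenvectorBasis.orthonormal.dotProduct_eq_ite]
  have hw : ∑ i, w i = m := by
    simp only [w]
    rw [Finset.sum_comm]
    simp only [dotProduct_comm _ (v _).ofLp, OrthonormalBasis.sum_sq_dotProduct]
    simp [hv.dotProduct_eq_ite]
  calc _ ≤ ∑ i, hH.eigenvalues (σ i) * w (σ i) :=
        sum_filter_le_sum_mul_of_monotone (f := hH.eigenvalues ∘ σ) (w := w ∘ σ) (Nat.sub_le N r)
          (Tuple.monotone_sort _) (fun i => gram_eigenvalues_nonneg R hH _) (fun i => hw0 _)
          (fun i => hw1 _) (by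
            simp only [Function.comp_apply]
            rw [Equiv.sum_comp σ w, hw]
            exact_mod_cast hm)
    _ = ∑ i, hH.eigenvalues i * w i := Equiv.sum_comp σ fun i => hH.eigenvalues i * w i
    _ = ∑ k, (R *ᵥ (v k).ofLp) ⬝ᵥ (R *ᵥ (v k).ofLp) := by
        simp only [mulVec_dotProduct_self_eq_sum_eigenvalues R hH, w, Finset.mul_sum]
        rw [Finset.sum_comm]
        simp only [dotProduct_comm]
    _ = ∑ k, ((R - E * Γᵀ) *ᵥ (v k).ofLp) ⬝ᵥ ((R - E * Γᵀ) *ᵥ (v k).ofLp) := by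
        simp only [Matrix.sub_mulVec, ← Matrix.mulVec_mulVec, hker, Matrix.mulVec_zero, sub_zero]
    _ ≤ _ := sum_orthonormal_le_frob_sq _ hv

/-- The Eckart–Young lower bound is attained. -/
lemma exists_frob_sq_sub_eq_sum_smallest_eigenvalues {d N : ℕ} (r : ℕ)
    (R : Matrix (Fin d) (Fin N) ℝ) (hH : (Rᵀ * R).IsHermitian) :
    ∃ (E : Matrix (Fin d) (Fin r) ℝ) (Γ : Matrix (Fin N) (Fin r) ℝ), frob (R - E * Γᵀ) ^ 2 =
      ∑ i ∈ Finset.univ.filter (fun i : Fin N => (i : ℕ) < N - r),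
        hH.eigenvalues (Tuple.sort hH.eigenvalues i) := by
  let σ := Tuple.sort hH.eigenvalues
  let u : Fin N → Fin N → ℝ := fun i => (hH.eigenvectorBasis (σ i)).ofLp
  let top : Fin r → Fin N → ℝ := fun k =>
    if h : (k : ℕ) < N then u (Fin.rev ⟨k, h⟩) else 0
  let Γ : Matrix (Fin N) (Fin r) ℝ := (Matrix.of top)ᵀ
  have hu : ∀ i j, u i ⬝ᵥ u j = if i = j then 1 else 0 := fun i j => by
    simp [u, hH.eigenvectorBasis.orthonormal.dotProduct_eq_ite]
  have htop : ∀ j : Fin N, Γ *ᵥ (Γᵀ *ᵥ u j) = if (j : ℕ) < N - r then 0 else u j := by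
    intro j
    have hcoord : ∀ k, (Γᵀ *ᵥ u j) k = if (k : ℕ) = Fin.rev j then 1 else 0 := by
      intro k
      change top k ⬝ᵥ u j = _
      by_cases h : (k : ℕ) < N
      · simp only [top, h, dite_true, hu, Fin.rev_eq_iff]
        simp only [Fin.ext_iff]
      · have : (k : ℕ) ≠ Fin.rev j := fun hk => h (hk ▸ (Fin.rev j).2)
        rw [if_neg this]
        simp [top, h]
    have hexp : Γ *ᵥ (Γᵀ *ᵥ u j) = ∑ k : Fin r, (if (k : ℕ) = Fin.rev j then top k else 0) := by
      ext l
      simp [Matrix.mulVec, dotProduct, Γ] at hcoord ⊢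
      simp only [hcoord, mul_ite, mul_one, mul_zero]
      exact Finset.sum_congr rfl fun k _ => by split_ifs <;> rfl
    rw [hexp]
    split_ifs with hj
    · refine Finset.sum_eq_zero fun k _ => if_neg ?_
      simp only [Fin.val_rev]
      omega
    · have hlt : (Fin.rev j : ℕ) < r := by simp only [Fin.val_rev]; omega
      rw [Finset.sum_eq_single ⟨Fin.rev j, hlt⟩]
      · simp only [top, (Fin.rev j).2, dite_true, if_true, Fin.eta, Fin.rev_rev]
      · intro k _ hk
        exact if_neg fun h => hk (Fin.ext h)
      · simp
  refine ⟨R * Γ, Γ, ?_⟩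
  rw [frob_sq_eq_sum_basis _ (hH.eigenvectorBasis.reindex σ.symm), Finset.sum_filter]
  refine Finset.sum_congr rfl fun j _ => ?_
  have : (R - R * Γ * Γᵀ) *ᵥ ((hH.eigenvectorBasis.reindex σ.symm) j).ofLp =
      if (j : ℕ) < N - r then R *ᵥ u j else 0 := by
    rw [OrthonormalBasis.reindex_apply, Equiv.symm_symm]
    change (R - R * Γ * Γᵀ) *ᵥ u j = _
    rw [Matrix.sub_mulVec, ← Matrix.mulVec_mulVec, ← Matrix.mulVec_mulVec, htop]
    split_ifs <;> simp
  rw [this]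
  split_ifs
  · exact mulVec_eigenvector_dotProduct_self R hH _
  · simp

lemma exists_eq_add_mulVec_of_vecMul_eq_zero {d r : ℕ} (E : Matrix (Fin d) (Fin r) ℝ)
    (x : Fin d → ℝ) : ∃ (S : Fin d → ℝ) (c : Fin r → ℝ), S ᵥ* E = 0 ∧ x = S + E *ᵥ c := by
  obtain ⟨y, ⟨c, rfl⟩, z, hz, hx⟩ :=
    (LinearMap.range (Matrix.toEuclideanLin E)).exists_add_mem_mem_orthogonal (WithLp.toLp 2 x)
  refine ⟨z.ofLp, c.ofLp, ?_, ?_⟩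
  · refine dotProduct_eq_zero _ fun y => ?_
    have h := hz _ ⟨WithLp.toLp 2 y, rfl⟩
    rw [← dotProduct_mulVec, euclideanSpace_dotProduct_eq_inner z.ofLp (WithLp.toLp 2 (E *ᵥ y))]
    exact h
  · rw [add_comm]
    exact congrArg WithLp.ofLp hx

/-- Centering the rows does not increase the Frobenius norm. -/
lemma frob_sq_sub_colRep_mean_le {d N : ℕ} (A : Matrix (Fin d) (Fin N) ℝ) :
    frob (A - colRep N ((N : ℝ)⁻¹ • A *ᵥ ones N)) ^ 2 ≤ frob A ^ 2 := by
  rw [frob_sq, frob_sq]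
  refine Finset.sum_le_sum fun i _ => ?_
  rcases Nat.eq_zero_or_pos N with rfl | hN
  · simp [dotProduct]
  have hN' : (0 : ℝ) < N := by exact_mod_cast hN
  set a : ℝ := ∑ j, A i j with ha
  have h : ∀ j, (A - colRep N ((N : ℝ)⁻¹ • A *ᵥ ones N)) i j = A i j - (N : ℝ)⁻¹ * a := by
    intro j
    simp [colRep, ones, Matrix.mulVec, dotProduct, ha]
  simp only [dotProduct, h]
  have : ∑ j, (A i j - (N : ℝ)⁻¹ * a) * (A i j - (N : ℝ)⁻¹ * a) =
      ∑ j, A i j * A i j - (N : ℝ)⁻¹ * a ^ 2 := by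
    have e : ∀ j, (A i j - (N : ℝ)⁻¹ * a) * (A i j - (N : ℝ)⁻¹ * a) =
        A i j * A i j - 2 * ((N : ℝ)⁻¹ * a) * A i j + ((N : ℝ)⁻¹ * a) ^ 2 := fun j => by ring
    simp only [e, Finset.sum_add_distrib, Finset.sum_sub_distrib, ← Finset.mul_sum, ← ha,
      Finset.sum_const, Finset.card_univ, Fintype.card_fin, nsmul_eq_mul]
    field_simp
    ring
  rw [this]
  have : 0 ≤ (N : ℝ)⁻¹ * a ^ 2 := by positivity
  linarith

/-- (Optimal value of the constrained decomposition problem) With `S' = (1/N)·M𝟙` and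
`R = M − S'𝟙ᵀ`, the infimum of `‖M − S𝟙ᵀ − EΓᵀ‖_F²` over triples with `SᵀE = 0` is
attained and equals the sum of the `N − r` smallest eigenvalues (with multiplicity)
of `RᵀR`. -/
theorem constrained_optimal_value {d N : ℕ} (r : ℕ)
    (M : Matrix (Fin d) (Fin N) ℝ)
    (S' : Fin d → ℝ) (hS' : S' = (N : ℝ)⁻¹ • M.mulVec (ones N))
    (R : Matrix (Fin d) (Fin N) ℝ) (hR : R = M - colRep N S')
    (hH : (Rᵀ * R).IsHermitian) :
    ∃ (S : Fin d → ℝ) (E : Matrix (Fin d) (Fin r) ℝ) (Γ : Matrix (Fin N) (Fin r) ℝ),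
      Matrix.vecMul S E = 0 ∧
      (∀ (S₂ : Fin d → ℝ) (E₂ : Matrix (Fin d) (Fin r) ℝ) (Γ₂ : Matrix (Fin N) (Fin r) ℝ),
        Matrix.vecMul S₂ E₂ = 0 →
        frob (M - colRep N S - E * Γᵀ) ^ 2 ≤ frob (M - colRep N S₂ - E₂ * Γ₂ᵀ) ^ 2) ∧
      frob (M - colRep N S - E * Γᵀ) ^ 2 =
        ∑ i ∈ Finset.univ.filter (fun i : Fin N => (i : ℕ) < N - r),
          hH.eigenvalues (Tuple.sort hH.eigenvalues i) := by
  obtain ⟨E, Γ₀, hopt⟩ := exists_frob_sq_sub_eq_sum_smallest_eigenvalues r R hH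
  obtain ⟨S, c, hS, hdecomp⟩ := exists_eq_add_mulVec_of_vecMul_eq_zero E S'
  let Γ : Matrix (Fin N) (Fin r) ℝ := Γ₀ + Matrix.of fun _ k => c k
  have hval : M - colRep N S - E * Γᵀ = R - E * Γ₀ᵀ := by
    ext i j
    simp [hR, hdecomp, Γ, colRep, Matrix.mul_apply, Matrix.mulVec, dotProduct, mul_add,
      Finset.sum_add_distrib]
    ring
  refine ⟨S, E, Γ, hS, fun S₂ E₂ Γ₂ _ => ?_, hval ▸ hopt⟩
  rw [hval, hopt]
  let Γ₃ : Matrix (Fin N) (Fin r) ℝ :=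
    Γ₂ - Matrix.of fun _ k => (N : ℝ)⁻¹ * (Γ₂ᵀ *ᵥ ones N) k
  have hcenter : R - E₂ * Γ₃ᵀ = (M - colRep N S₂ - E₂ * Γ₂ᵀ) -
      colRep N ((N : ℝ)⁻¹ • (M - colRep N S₂ - E₂ * Γ₂ᵀ) *ᵥ ones N) := by
    ext i j
    have hN : (N : ℝ) ≠ 0 := by exact_mod_cast (Fin.pos j).ne'
    have hcol : (colRep N S₂ *ᵥ ones N) i = N * S₂ i := by
      simp [colRep, ones, Matrix.mulVec, dotProduct]
    have hmul : (E₂ * Γ₃ᵀ) i j =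
        (E₂ * Γ₂ᵀ) i j - (N : ℝ)⁻¹ * ((E₂ * Γ₂ᵀ) *ᵥ ones N) i := by
      rw [← Matrix.mulVec_mulVec]
      simp only [Γ₃, Matrix.mul_apply, Matrix.transpose_apply, Matrix.sub_apply, Matrix.of_apply,
        mul_sub, Finset.sum_sub_distrib]
      rw [Matrix.mulVec, dotProduct, Finset.mul_sum]
      simp only [mul_left_comm]
    simp only [Matrix.sub_apply, hmul, hR, hS', Matrix.sub_mulVec, colRep, Matrix.of_apply,
      Pi.smul_apply, Pi.sub_apply, smul_eq_mul] at hcol ⊢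
    rw [hcol]
    field_simp
    ring
  calc _ ≤ frob (R - E₂ * Γ₃ᵀ) ^ 2 := sum_smallest_eigenvalues_le_frob_sq_sub R hH E₂ Γ₃
    _ ≤ _ := hcenter ▸ frob_sq_sub_colRep_mean_le _
end
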